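/- Let F be a field and D a local subring of F. If Z is a nonempty Zariski closed and connected subspace of Dom_F(D), then A(Z) is a local domain that dominates D and is residually algebraic over D. -/

import Mathlib

/-!
Common definitions: valuation rings of a field, the Zariski--Riemann space
`Zar_F(D)` with its Zariski and patch topologies, domination of local subrings,
residual algebraicity, integral closedness, and projective models of `F/D`.
-/

variable {F : Type*} [Field F]

/-- `x` lies in the maximal ideal (set of nonunits) of the (local) subring `R` of `F`. -/
def MemMaxIdeal (R : Subring F) (x : F) : Prop :=
  ∃ h : x ∈ R, ¬ IsUnit (⟨x, h⟩ : R)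

/-- The local ring `R` dominates the local ring `S` (both subrings of `F`):
`S ⊆ R` and the maximal ideal of `R` contracts to the maximal ideal of `S`. -/
def Dominates (R S : Subring F) : Prop :=
  S ≤ R ∧ ∀ x ∈ S, (MemMaxIdeal S x ↔ MemMaxIdeal R x)

/-- `V` is a valuation ring of the field `F`: for every nonzero `x ∈ F`,
`x ∈ V` or `x⁻¹ ∈ V`. -/
def IsValSubring (V : Subring F) : Prop :=
  ∀ x : F, x ≠ 0 → x ∈ V ∨ x⁻¹ ∈ V

/-- `Zar_F(D)`: the valuation rings of `F` containing `D`. -/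
def zarSet (D : Subring F) : Set (Subring F) :=
  {V | IsValSubring V ∧ D ≤ V}

/-- `Dom_F(D)`: the valuation rings of `F` dominating the local subring `D`. -/
def domSet (D : Subring F) : Set (Subring F) :=
  {V | IsValSubring V ∧ Dominates V D}

/-- The Zariski topology on a collection `X` of subrings of `F`, with basic open sets
`U(x₁,…,xₙ) = {R ∈ X : x₁,…,xₙ ∈ R}`. -/
def zariskiTop (X : Set (Subring F)) : TopologicalSpace X :=
  TopologicalSpace.generateFrom
    {U | ∃ s : Finset F, U = {R : X | ∀ x ∈ s, x ∈ (R : Subring F)}}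

/-- The patch topology on a collection `X` of subrings of `F`: generated by the
quasicompact Zariski-open sets together with their complements. -/
def patchTop (X : Set (Subring F)) : TopologicalSpace X :=
  TopologicalSpace.generateFrom
    ({U | @IsOpen _ (zariskiTop X) U ∧ @IsCompact _ (zariskiTop X) U} ∪
      {V | ∃ U, @IsOpen _ (zariskiTop X) U ∧ @IsCompact _ (zariskiTop X) U ∧ V = Uᶜ})

/-- `R` is residually algebraic over `D`: the residue field extension
`D/m_D → R/m_R` is algebraic, i.e. each element of `R` satisfies, modulo the
maximal ideal of `R`, a monic polynomial with coefficients in `D`. -/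
def ResiduallyAlgebraic (D R : Subring F) : Prop :=
  ∀ x ∈ R, ∃ p : Polynomial F, p.Monic ∧ (∀ i, p.coeff i ∈ D) ∧ MemMaxIdeal R (p.eval x)

/-- `R` is integrally closed in `F`: every element of `F` integral over `R` lies in `R`. -/
def IntegrallyClosedIn (R : Subring F) : Prop :=
  ∀ x : F, (∃ p : Polynomial F, p.Monic ∧ (∀ i, p.coeff i ∈ R) ∧ p.eval x = 0) → x ∈ R

/-- The localization of the subring `A` of `F` at the prime ideal `P`, viewed as the
subring of `F` generated by the fractions `a/b` with `a, b ∈ A`, `b ∉ P`. -/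
def localizationSubring (A : Subring F) (P : Ideal A) : Subring F :=
  Subring.closure {z : F | ∃ a b : A, b ∉ P ∧ z = (a : F) * (b : F)⁻¹}

/-- The ring `D[x₁/xᵢ, …, xₙ/xᵢ]`. -/
def modelChart (D : Subring F) {n : ℕ} (x : Fin n → F) (i : Fin n) : Subring F :=
  Subring.closure ((D : Set F) ∪ {y | ∃ j, y = x j * (x i)⁻¹})

/-- `X` is the projective model of `F/D` defined by some nonzero elements
`x₀, …, xₙ` of `F`: the set of all localizations of the rings
`D[x₀/xᵢ, …, xₙ/xᵢ]` at their prime ideals. -/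
def IsProjModel (D : Subring F) (X : Set (Subring F)) : Prop :=
  ∃ (n : ℕ) (x : Fin (n + 1) → F), (∀ i, x i ≠ 0) ∧
    X = {R | ∃ (i : Fin (n + 1)) (P : Ideal (modelChart D x i)),
          P.IsPrime ∧ R = localizationSubring (modelChart D x i) P}

/-- `X(Z)`: the members of the projective model `X` dominated by some valuation ring
in `Z`. -/
def modelImage (X Z : Set (Subring F)) : Set (Subring F) :=
  {α ∈ X | ∃ V ∈ Z, Dominates V α}

/-- `A(Y)`: the intersection of a collection `Y` of subrings of `F`, as a subset of `F`. -/
def ringsInter (Y : Set (Subring F)) : Set F :=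
  ⋂ R ∈ Y, (R : Set F)

open Polynomial

theorem Subring.isUnit_mk_iff {R : Subring F} {x : F} (h : x ∈ R) :
    IsUnit (⟨x, h⟩ : R) ↔ x ≠ 0 ∧ x⁻¹ ∈ R := by
  constructor
  · intro hu
    obtain ⟨y, hy⟩ := hu.exists_right_inv
    have hxy : x * (y : F) = 1 := congrArg Subtype.val hy
    exact ⟨left_ne_zero_of_mul_eq_one hxy, inv_eq_of_mul_eq_one_right hxy ▸ y.2⟩
  · rintro ⟨h0, hi⟩
    exact IsUnit.of_mul_eq_one ⟨x⁻¹, hi⟩ (Subtype.ext (mul_inv_cancel₀ h0))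

theorem memMaxIdeal_iff {R : Subring F} {x : F} :
    MemMaxIdeal R x ↔ x ∈ R ∧ (x = 0 ∨ x⁻¹ ∉ R) := by
  constructor
  · rintro ⟨h, hu⟩
    rw [Subring.isUnit_mk_iff h] at hu
    exact ⟨h, by tauto⟩
  · rintro ⟨h, hu⟩
    exact ⟨h, by rw [Subring.isUnit_mk_iff h]; tauto⟩

theorem MemMaxIdeal.mem {R : Subring F} {x : F} (h : MemMaxIdeal R x) : x ∈ R := h.1

theorem not_memMaxIdeal_one (R : Subring F) : ¬ MemMaxIdeal R 1 := by
  simp [memMaxIdeal_iff, R.one_mem]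

theorem memMaxIdeal_or_of_mul {R : Subring F} {x y : F} (hx : x ∈ R) (hy : y ∈ R)
    (hxy : MemMaxIdeal R (x * y)) : MemMaxIdeal R x ∨ MemMaxIdeal R y := by
  by_contra! h
  simp only [memMaxIdeal_iff, hx, hy, true_and, not_or, not_not] at h
  rcases (memMaxIdeal_iff.1 hxy).2 with h0 | h0
  · exact mul_ne_zero h.1.1 h.2.1 h0
  · exact h0 (mul_inv x y ▸ R.mul_mem h.1.2 h.2.2)

namespace IsValSubring

variable {V : Subring F}

/-- The valuation subring with underlying subring `V`. -/
def toValuationSubring (hV : IsValSubring V) : ValuationSubring F where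
  toSubring := V
  mem_or_inv_mem' x := by
    by_cases h : x = 0
    · exact Or.inl (h ▸ V.zero_mem)
    · exact hV x h

theorem memMaxIdeal_iff_mem_nonunits (hV : IsValSubring V) {x : F} :
    MemMaxIdeal V x ↔ x ∈ hV.toValuationSubring.nonunits := by
  rw [ValuationSubring.mem_nonunits_iff_or, memMaxIdeal_iff]
  refine and_iff_right_of_imp ?_
  rintro (rfl | h)
  · exact V.zero_mem
  · exact (hV.toValuationSubring.mem_or_inv_mem x).resolve_right h

theorem memMaxIdeal_zero (hV : IsValSubring V) : MemMaxIdeal V 0 :=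
  hV.memMaxIdeal_iff_mem_nonunits.2 (zero_mem _)

theorem memMaxIdeal_add (hV : IsValSubring V) {x y : F} (hx : MemMaxIdeal V x)
    (hy : MemMaxIdeal V y) : MemMaxIdeal V (x + y) := by
  rw [hV.memMaxIdeal_iff_mem_nonunits] at *
  exact add_mem hx hy

theorem memMaxIdeal_neg (hV : IsValSubring V) {x : F} (hx : MemMaxIdeal V x) :
    MemMaxIdeal V (-x) := by
  rw [hV.memMaxIdeal_iff_mem_nonunits] at *
  exact neg_mem hx

theorem memMaxIdeal_sub (hV : IsValSubring V) {x y : F} (hx : MemMaxIdeal V x)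
    (hy : MemMaxIdeal V y) : MemMaxIdeal V (x - y) := by
  rw [hV.memMaxIdeal_iff_mem_nonunits] at *
  exact sub_mem hx hy

theorem memMaxIdeal_mul_right (hV : IsValSubring V) {x y : F} (hx : MemMaxIdeal V x)
    (hy : y ∈ V) : MemMaxIdeal V (x * y) := by
  rw [hV.memMaxIdeal_iff_mem_nonunits, ValuationSubring.mem_nonunits_iff] at *
  rw [map_mul]
  exact mul_lt_one_of_lt_of_le hx ((hV.toValuationSubring.valuation_le_one_iff y).2 hy)

theorem memMaxIdeal_mul_left (hV : IsValSubring V) {x y : F} (hx : x ∈ V)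
    (hy : MemMaxIdeal V y) : MemMaxIdeal V (x * y) :=
  mul_comm y x ▸ hV.memMaxIdeal_mul_right hy hx

end IsValSubring

theorem Subring.aeval_mem_of_le {D V : Subring F} (hDV : D ≤ V) {x : F} (hx : x ∈ V) (p : D[X]) :
    aeval x p ∈ V := by
  rw [aeval_eq_sum_range]
  refine V.sum_mem fun i _ => ?_
  rw [Algebra.smul_def]
  exact V.mul_mem (hDV (p.coeff i).2) (V.pow_mem hx i)

theorem aeval_eq_mul_aeval_divX_add {D : Subring F} (x : F) (p : D[X]) :
    aeval x p = x * aeval x p.divX + (p.coeff 0 : F) := by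
  conv_lhs => rw [← X_mul_divX_add p, map_add, map_mul, aeval_X, aeval_C]
  rfl

/-- The elements of `F` congruent modulo the maximal ideal of `V` to an element of `D[x]`. -/
def residualAdjoin {D V : Subring F} (hV : IsValSubring V) (hDV : D ≤ V) {x : F} (hx : x ∈ V) :
    Subring F where
  carrier := {y | ∃ q : D[X], MemMaxIdeal V (y - aeval x q)}
  mul_mem' := by
    rintro a b ⟨p, hp⟩ ⟨q, hq⟩
    refine ⟨p * q, ?_⟩
    have hb : b ∈ V := by
      simpa using V.add_mem hq.mem (Subring.aeval_mem_of_le hDV hx q)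
    have h : a * b - aeval x (p * q) =
        (a - aeval x p) * b + aeval x p * (b - aeval x q) := by
      rw [map_mul]; ring
    rw [h]
    exact hV.memMaxIdeal_add (hV.memMaxIdeal_mul_right hp hb)
      (hV.memMaxIdeal_mul_left (Subring.aeval_mem_of_le hDV hx p) hq)
  one_mem' := ⟨1, by simpa using hV.memMaxIdeal_zero⟩
  add_mem' := by
    rintro a b ⟨p, hp⟩ ⟨q, hq⟩
    refine ⟨p + q, ?_⟩
    rw [map_add, add_sub_add_comm]
    exact hV.memMaxIdeal_add hp hq
  zero_mem' := ⟨0, by simpa using hV.memMaxIdeal_zero⟩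
  neg_mem' := by
    rintro a ⟨p, hp⟩
    refine ⟨-p, ?_⟩
    rw [map_neg, ← neg_sub']
    exact hV.memMaxIdeal_neg hp

/-- The ideal of `residualAdjoin hV hDV hx` generated by `x` and the maximal ideal of `V`. -/
def residualIdeal {D V : Subring F} (hV : IsValSubring V) (hDV : D ≤ V) {x : F} (hx : x ∈ V) :
    Ideal (residualAdjoin hV hDV hx) where
  carrier := {y | ∃ q : D[X], MemMaxIdeal V ((y : F) - aeval x (X * q))}
  add_mem' := by
    rintro a b ⟨p, hp⟩ ⟨q, hq⟩
    refine ⟨p + q, ?_⟩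
    rw [mul_add, map_add, Subring.coe_add, add_sub_add_comm]
    exact hV.memMaxIdeal_add hp hq
  zero_mem' := ⟨0, by simpa using hV.memMaxIdeal_zero⟩
  smul_mem' := by
    rintro ⟨a, p, hp⟩ ⟨b, hb⟩ ⟨q, hq⟩
    replace hq : MemMaxIdeal V (b - aeval x (X * q)) := hq
    refine ⟨p * q, ?_⟩
    have hbV : b ∈ V := by
      have h := V.add_mem hq.mem (Subring.aeval_mem_of_le hDV hx (X * q))
      rwa [sub_add_cancel b (aeval x (X * q))] at h
    have h : a * b - aeval x (X * (p * q)) =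
        (a - aeval x p) * b + aeval x p * (b - aeval x (X * q)) := by
      simp only [map_mul]; ring
    change MemMaxIdeal V (a * b - aeval x (X * (p * q)))
    rw [h]
    exact hV.memMaxIdeal_add (hV.memMaxIdeal_mul_right hp hbV)
      (hV.memMaxIdeal_mul_left (Subring.aeval_mem_of_le hDV hx p) hq)

/-- If the residue of `t` in `V` is transcendental over `D`, then `V` has a specialization, with
larger maximal ideal, that does not contain `t`. -/
theorem exists_specialization_of_residually_transcendental {D V : Subring F}
    (hV : IsValSubring V) (hDV : D ≤ V) {t : F} (ht : t ∈ V)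
    (htr : ∀ p : D[X], p.Monic → ¬ MemMaxIdeal V (aeval t p)) :
    ∃ W : Subring F, IsValSubring W ∧ D ≤ W ∧ W ≤ V ∧ t ∉ W ∧
      ∀ x, MemMaxIdeal V x → MemMaxIdeal W x := by
  obtain ⟨ht0, hti⟩ : t ≠ 0 ∧ t⁻¹ ∈ V := by
    have := htr X monic_X
    simpa [memMaxIdeal_iff, ht] using this
  have hI : residualIdeal hV hDV hti ≠ ⊤ := by
    rw [Ideal.ne_top_iff_one]
    rintro ⟨q, hq⟩
    have hq' : MemMaxIdeal V (aeval t⁻¹ (1 - X * q)) := by simpa using hq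
    set f : D[X] := 1 - X * q with hf
    have hf0 : f.coeff 0 = 1 := by simp [hf]
    have hmonic : f.reverse.Monic := by
      rw [Monic, reverse_leadingCoeff, trailingCoeff, natTrailingDegree_eq_zero.2, hf0]
      exact Or.inr (by simp [hf0])
    refine htr _ hmonic ?_
    let _ : Invertible t⁻¹ := invertibleOfNonzero (inv_ne_zero ht0)
    have h := eval₂_reverse_mul_pow (algebraMap D F) t⁻¹ f
    rw [invOf_eq_inv, inv_inv, ← aeval_def, ← aeval_def] at h
    have h' : aeval t f.reverse = aeval t⁻¹ f * t ^ f.natDegree := by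
      rw [← h, mul_assoc, ← mul_pow, inv_mul_cancel₀ ht0, one_pow, mul_one]
    rw [h']
    exact hV.memMaxIdeal_mul_right hq' (V.pow_mem ht _)
  obtain ⟨W, hBW, hIW⟩ := Ideal.image_subset_nonunits_valuationSubring _ hI
  have hW : IsValSubring W.toSubring := fun x _ => W.mem_or_inv_mem x
  have hmem : ∀ x, (∃ q : D[X], MemMaxIdeal V (x - aeval t⁻¹ (X * q))) →
      MemMaxIdeal W.toSubring x := fun x ⟨q, hq⟩ =>
    hW.memMaxIdeal_iff_mem_nonunits.2 (hIW ⟨⟨x, X * q, hq⟩, ⟨q, hq⟩, rfl⟩)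
  have hmax : ∀ x, MemMaxIdeal V x → MemMaxIdeal W.toSubring x := fun x hx =>
    hmem x ⟨0, by simpa using hx⟩
  have htW : MemMaxIdeal W.toSubring t⁻¹ := hmem _ ⟨1, by simpa using hV.memMaxIdeal_zero⟩
  refine ⟨W.toSubring, hW, fun d hd => hBW ⟨C ⟨d, hd⟩, ?_⟩, fun x hx => ?_, ?_, hmax⟩
  · rw [aeval_C]
    exact (sub_self d).symm ▸ hV.memMaxIdeal_zero
  · by_contra hxV
    have hx0 : x ≠ 0 := fun h => hxV (h ▸ V.zero_mem)
    have h := hmax x⁻¹ (memMaxIdeal_iff.2 ⟨(hV x hx0).resolve_left hxV, by simp [hxV]⟩)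
    have := (memMaxIdeal_iff.1 h).2
    rw [inv_inv] at this
    exact this.elim (inv_ne_zero hx0) fun h => h hx
  · have := (memMaxIdeal_iff.1 htW).2
    rw [inv_inv] at this
    exact this.resolve_left (inv_ne_zero ht0)

theorem dominates_of_le {R S : Subring F} (h : S ≤ R)
    (hmax : ∀ x, MemMaxIdeal S x → MemMaxIdeal R x) : Dominates R S := by
  refine ⟨h, fun x hx => ⟨hmax x, fun hR => ?_⟩⟩
  rw [memMaxIdeal_iff] at *
  exact ⟨hx, hR.2.imp_right fun hn hS => hn (h hS)⟩

/-- A ring all of whose finite subsets are contained in members of a Zariski closed set lies in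
that set. -/
theorem mem_of_isClosed_zariskiTop {X : Set (Subring F)} {Z : Set X}
    (hcl : @IsClosed _ (zariskiTop X) Z) {W : X}
    (hW : ∀ s : Finset F, (∀ x ∈ s, x ∈ (W : Subring F)) →
      ∃ V ∈ Z, ∀ x ∈ s, x ∈ (V : Subring F)) : W ∈ Z := by
  classical
  by_contra hWZ
  have key : ∀ O : Set X, @IsOpen _ (zariskiTop X) O → W ∈ O →
      ∃ s : Finset F, (∀ x ∈ s, x ∈ (W : Subring F)) ∧
        ∀ V : X, (∀ x ∈ s, x ∈ (V : Subring F)) → V ∈ O := by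
    intro O hO
    induction hO with
    | basic O hO =>
      obtain ⟨s, rfl⟩ := hO
      exact fun h => ⟨s, h, fun _ hV => hV⟩
    | univ => exact fun _ => ⟨∅, by simp, fun _ _ => trivial⟩
    | inter O₁ O₂ _ _ ih₁ ih₂ =>
      rintro ⟨h₁, h₂⟩
      obtain ⟨s, hs, hs'⟩ := ih₁ h₁
      obtain ⟨r, hr, hr'⟩ := ih₂ h₂
      refine ⟨s ∪ r, fun x hx => (Finset.mem_union.1 hx).elim (hs x) (hr x), fun V hV =>
        ⟨hs' V fun x hx => hV x (Finset.mem_union_left _ hx),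
          hr' V fun x hx => hV x (Finset.mem_union_right _ hx)⟩⟩
    | sUnion S _ ih =>
      rintro ⟨O, hOS, hWO⟩
      obtain ⟨s, hs, hs'⟩ := ih O hOS hWO
      exact ⟨s, hs, fun V hV => ⟨O, hOS, hs' V hV⟩⟩
  obtain ⟨s, hs, hs'⟩ := key Zᶜ hcl.isOpen_compl hWZ
  obtain ⟨V, hVZ, hV⟩ := hW s hs
  exact hs' V hV hVZ

theorem isOpen_zariskiTop_mem (X : Set (Subring F)) (x : F) :
    @IsOpen _ (zariskiTop X) {V : X | x ∈ (V : Subring F)} :=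
  TopologicalSpace.isOpen_generateFrom_of_mem ⟨{x}, by simp⟩

section

variable {D : Subring F} {Z : Set (domSet D)}

theorem mem_of_specializes (hcl : @IsClosed _ (zariskiTop (domSet D)) Z) {V W : domSet D}
    (hV : V ∈ Z) (hWV : (W : Subring F) ≤ V) : W ∈ Z :=
  mem_of_isClosed_zariskiTop hcl fun _ hs => ⟨V, hV, fun x hx => hWV (hs x hx)⟩

theorem exists_monic_memMaxIdeal_of_mem (hcl : @IsClosed _ (zariskiTop (domSet D)) Z) {t : F}
    (ht : ∀ V ∈ Z, t ∈ (V : Subring F)) {V : domSet D} (hV : V ∈ Z) :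
    ∃ p : D[X], p.Monic ∧ MemMaxIdeal (V : Subring F) (aeval t p) := by
  by_contra! h
  obtain ⟨W, hW, hDW, hWV, htW, hmax⟩ :=
    exists_specialization_of_residually_transcendental V.2.1 V.2.2.1 (ht V hV) h
  have hdom : W ∈ domSet D :=
    ⟨hW, dominates_of_le hDW fun x hx => hmax x ((V.2.2.2 x hx.mem).1 hx)⟩
  exact htW (ht ⟨W, hdom⟩ (mem_of_specializes hcl hV hWV))

/-- The ring of elements lying in almost all members of a family of subrings. -/
def ultraLimit {ι : Type*} (V : ι → Subring F) (U : Ultrafilter ι) : Subring F where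
  carrier := {x | ∀ᶠ i in (U : Filter ι), x ∈ V i}
  mul_mem' ha hb := by filter_upwards [ha, hb] with i using (V i).mul_mem
  one_mem' := .of_forall fun i => (V i).one_mem
  add_mem' ha hb := by filter_upwards [ha, hb] with i using (V i).add_mem
  zero_mem' := .of_forall fun i => (V i).zero_mem
  neg_mem' ha := by filter_upwards [ha] with i using (V i).neg_mem

theorem ultraLimit_mem_domSet {ι : Type*} (V : ι → domSet D) (U : Ultrafilter ι) :
    ultraLimit (fun i => (V i : Subring F)) U ∈ domSet D := by
  refine ⟨fun x hx => ?_, dominates_of_le (fun x hx => ?_) fun x hx => ?_⟩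
  · exact Ultrafilter.eventually_or.1 (.of_forall fun i => (V i).2.1 x hx)
  · exact .of_forall fun i => (V i).2.2.1 hx
  · refine memMaxIdeal_iff.2 ⟨.of_forall fun i => (V i).2.2.1 hx.mem, ?_⟩
    by_cases h0 : x = 0
    · exact Or.inl h0
    · refine Or.inr fun h => ?_
      obtain ⟨i, hi⟩ := Filter.Eventually.exists (f := (U : Filter ι)) h
      exact (memMaxIdeal_iff.1 (((V i).2.2.2 x hx.mem).1 hx)).2.elim h0 fun h => h hi

theorem ultraLimit_mem (hcl : @IsClosed _ (zariskiTop (domSet D)) Z) {U : Ultrafilter (domSet D)}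
    (hU : Z ∈ U) : ⟨ultraLimit Subtype.val U, ultraLimit_mem_domSet id U⟩ ∈ Z := by
  refine mem_of_isClosed_zariskiTop hcl fun s hs => ?_
  have h : ∀ᶠ V : domSet D in (U : Filter _), ∀ x ∈ s, x ∈ (V : Subring F) :=
    (Filter.eventually_all_finset s).2 hs
  exact (Filter.Eventually.and hU h).exists

/-- An element of `A(Z)` satisfies one monic polynomial over `D` modulo all the maximal ideals of
members of `Z`. -/
theorem exists_monic_forall_memMaxIdeal (hcl : @IsClosed _ (zariskiTop (domSet D)) Z) {t : F}
    (ht : ∀ V ∈ Z, t ∈ (V : Subring F)) :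
    ∃ p : D[X], p.Monic ∧ ∀ V ∈ Z, MemMaxIdeal (V : Subring F) (aeval t p) := by
  by_contra! h
  let S : {p : D[X] // p.Monic} → Set (domSet D) := fun p =>
    {V | V ∈ Z ∧ ¬ MemMaxIdeal (V : Subring F) (aeval t p.1)}
  have : Nonempty {p : D[X] // p.Monic} := ⟨⟨1, monic_one⟩⟩
  have hne : (⨅ p, Filter.principal (S p)).NeBot := by
    refine Filter.iInf_neBot_of_directed' (fun p q => ⟨⟨p.1 * q.1, p.2.mul q.2⟩, ?_, ?_⟩)
      fun p => Filter.principal_neBot_iff.2 (h p.1 p.2)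
    · refine Filter.principal_mono.2 fun V hV => ⟨hV.1, fun hp => hV.2 ?_⟩
      rw [map_mul]
      exact V.2.1.memMaxIdeal_mul_right hp (Subring.aeval_mem_of_le V.2.2.1 (ht V hV.1) _)
    · refine Filter.principal_mono.2 fun V hV => ⟨hV.1, fun hp => hV.2 ?_⟩
      rw [map_mul]
      exact V.2.1.memMaxIdeal_mul_left (Subring.aeval_mem_of_le V.2.2.1 (ht V hV.1) _) hp
  let U := Ultrafilter.of (⨅ p, Filter.principal (S p))
  have hU : ∀ p, S p ∈ U := fun p =>
    Ultrafilter.of_le _ (Filter.mem_iInf_of_mem p (Filter.mem_principal_self _))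
  have hZ : Z ∈ U := Filter.mem_of_superset (hU ⟨1, monic_one⟩) fun V hV => hV.1
  obtain ⟨p, hp, hpW⟩ := exists_monic_memMaxIdeal_of_mem hcl ht (ultraLimit_mem hcl hZ)
  have hev : ∀ᶠ V : domSet D in (U : Filter _),
      aeval t p ≠ 0 ∧ (aeval t p)⁻¹ ∈ (V : Subring F) := by
    filter_upwards [hU ⟨p, hp⟩] with V hV
    have := hV.2
    simpa [memMaxIdeal_iff, Subring.aeval_mem_of_le V.2.2.1 (ht V hV.1) p] using this
  exact (memMaxIdeal_iff.1 hpW).2.elim hev.exists.choose_spec.1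
    fun hn => hn (hev.mono fun V hV => hV.2)

theorem exists_coeff_zero_isUnit_memMaxIdeal_or {t : F} (ht : ∀ V ∈ Z, t ∈ (V : Subring F))
    (k : ℕ) (p : D[X]) (hk : IsUnit (p.coeff k))
    (hp : ∀ V ∈ Z, MemMaxIdeal (V : Subring F) t ∨ MemMaxIdeal (V : Subring F) (aeval t p)) :
    ∃ q : D[X], IsUnit (q.coeff 0) ∧
      ∀ V ∈ Z, MemMaxIdeal (V : Subring F) t ∨ MemMaxIdeal (V : Subring F) (aeval t q) := by
  induction k generalizing p with
  | zero => exact ⟨p, hk, hp⟩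
  | succ k ih =>
    by_cases h0 : IsUnit (p.coeff 0)
    · exact ⟨p, h0, hp⟩
    · refine ih p.divX (by rwa [coeff_divX]) fun V hV => (hp V hV).elim Or.inl fun h => ?_
      have hc : MemMaxIdeal (V : Subring F) (p.coeff 0 : F) :=
        (V.2.2.2 _ (p.coeff 0).2).1 ⟨(p.coeff 0).2, h0⟩
      have h' : t * aeval t p.divX = aeval t p - (p.coeff 0 : F) := by
        rw [aeval_eq_mul_aeval_divX_add t p, add_sub_cancel_right]
      exact memMaxIdeal_or_of_mul (ht V hV)
        (Subring.aeval_mem_of_le V.2.2.1 (ht V hV) _) (h' ▸ V.2.1.memMaxIdeal_sub h hc)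

/-- An element of `A(Z)` is a nonunit in every member of `Z` or a unit in every member of `Z`. -/
theorem forall_memMaxIdeal_or_forall_not (hcl : @IsClosed _ (zariskiTop (domSet D)) Z)
    (hconn : @IsPreconnected _ (zariskiTop (domSet D)) Z) {t : F}
    (ht : ∀ V ∈ Z, t ∈ (V : Subring F)) :
    (∀ V ∈ Z, MemMaxIdeal (V : Subring F) t) ∨ ∀ V ∈ Z, ¬ MemMaxIdeal (V : Subring F) t := by
  obtain ⟨p, hpm, hp⟩ := exists_monic_forall_memMaxIdeal hcl ht
  obtain ⟨q, hq0, hq⟩ := exists_coeff_zero_isUnit_memMaxIdeal_or ht p.natDegree p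
    (by rw [hpm.coeff_natDegree]; exact isUnit_one) fun V hV => Or.inr (hp V hV)
  have hqV : ∀ V ∈ Z, aeval t q ∈ (V : Subring F) := fun V hV =>
    Subring.aeval_mem_of_le V.2.2.1 (ht V hV) q
  have hdisj : ∀ V ∈ Z, MemMaxIdeal (V : Subring F) t →
      ¬ MemMaxIdeal (V : Subring F) (aeval t q) := by
    intro V hV h₁ h₂
    have h' : (q.coeff 0 : F) = aeval t q - t * aeval t q.divX := by
      rw [aeval_eq_mul_aeval_divX_add t q, add_sub_cancel_left]
    have h : MemMaxIdeal (V : Subring F) (q.coeff 0 : F) := h' ▸ V.2.1.memMaxIdeal_sub h₂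
      (V.2.1.memMaxIdeal_mul_right h₁ (Subring.aeval_mem_of_le V.2.2.1 (ht V hV) _))
    exact ((V.2.2.2 _ (q.coeff 0).2).2 h).2 hq0
  by_cases ht0 : t = 0
  · exact Or.inl fun V _ => ht0 ▸ V.2.1.memMaxIdeal_zero
  by_cases hqt0 : aeval t q = 0
  · exact Or.inr fun V hV h => hdisj V hV h (hqt0 ▸ V.2.1.memMaxIdeal_zero)
  by_contra! hcon
  obtain ⟨⟨V₁, hV₁, h₁⟩, V₂, hV₂, h₂⟩ := hcon
  have iff_t : ∀ V ∈ Z, ¬ MemMaxIdeal (V : Subring F) t ↔ t⁻¹ ∈ (V : Subring F) := fun V hV => by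
    simp [memMaxIdeal_iff, ht V hV, ht0]
  have iff_q : ∀ V ∈ Z, ¬ MemMaxIdeal (V : Subring F) (aeval t q) ↔
      (aeval t q)⁻¹ ∈ (V : Subring F) := fun V hV => by
    simp [memMaxIdeal_iff, hqV V hV, hqt0]
  obtain ⟨V, hV, ht', hq'⟩ := hconn _ _ (isOpen_zariskiTop_mem _ t⁻¹)
    (isOpen_zariskiTop_mem _ (aeval t q)⁻¹)
    (fun V hV => (em (MemMaxIdeal (V : Subring F) t)).symm.imp (iff_t V hV).1
      fun h => (iff_q V hV).1 (hdisj V hV h))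
    ⟨V₁, hV₁, (iff_t V₁ hV₁).1 h₁⟩ ⟨V₂, hV₂, (iff_q V₂ hV₂).1 (hdisj V₂ hV₂ h₂)⟩
  exact (hq V hV).elim ((iff_t V hV).2 ht') ((iff_q V hV).2 hq')

end

theorem mem_sInf_val_image {X : Set (Subring F)} {Z : Set X} {x : F} :
    x ∈ sInf (Subtype.val '' Z) ↔ ∀ V ∈ Z, x ∈ (V : Subring F) := by
  simp only [Subring.mem_sInf, Set.forall_mem_image]

theorem isUnit_sInf_of_forall_not_memMaxIdeal {X : Set (Subring F)} {Z : Set X}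
    (hne : Z.Nonempty) {x : F} (hx : x ∈ sInf (Subtype.val '' Z))
    (h : ∀ V ∈ Z, ¬ MemMaxIdeal (V : Subring F) x) :
    IsUnit (⟨x, hx⟩ : ↥(sInf (Subtype.val '' Z))) := by
  have h' : ∀ V ∈ Z, x ≠ 0 ∧ x⁻¹ ∈ (V : Subring F) := fun V hV => by
    have := h V hV
    simpa [memMaxIdeal_iff, mem_sInf_val_image.1 hx V hV] using this
  obtain ⟨V, hV⟩ := hne
  exact (Subring.isUnit_mk_iff hx).2 ⟨(h' V hV).1, mem_sInf_val_image.2 fun V hV => (h' V hV).2⟩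

theorem memMaxIdeal_sInf {X : Set (Subring F)} {Z : Set X} {x : F}
    (hx : x ∈ sInf (Subtype.val '' Z)) {V : X} (hV : V ∈ Z)
    (h : MemMaxIdeal (V : Subring F) x) : MemMaxIdeal (sInf (Subtype.val '' Z)) x :=
  memMaxIdeal_iff.2 ⟨hx, (memMaxIdeal_iff.1 h).2.imp_right fun hn hi =>
    hn (mem_sInf_val_image.1 hi V hV)⟩

/-- If `Z` is a nonempty Zariski closed and connected subspace of `Dom_F(D)`, with `D`
a local subring of `F`, then `A(Z)` is a local domain dominating `D` and residually
algebraic over `D`. -/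
theorem statement17 (D : Subring F) (hD : IsLocalRing D)
    (Z : Set ↥(domSet D)) (hne : Z.Nonempty)
    (hcl : @IsClosed _ (zariskiTop (domSet D)) Z)
    (hconn : @IsConnected _ (zariskiTop (domSet D)) Z) :
    IsLocalRing ↥(sInf (Subtype.val '' Z)) ∧
    IsDomain ↥(sInf (Subtype.val '' Z)) ∧
    Dominates (sInf (Subtype.val '' Z)) D ∧
    ResiduallyAlgebraic D (sInf (Subtype.val '' Z)) := by
  obtain ⟨V₀, hV₀⟩ := hne
  refine ⟨?_, inferInstance, ?_, ?_⟩
  · refine IsLocalRing.of_isUnit_or_isUnit_one_sub_self fun a => ?_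
    rcases forall_memMaxIdeal_or_forall_not hcl hconn.2
      (mem_sInf_val_image.1 a.2) with h | h
    · refine Or.inr (isUnit_sInf_of_forall_not_memMaxIdeal ⟨V₀, hV₀⟩ (1 - a).2 fun V hV h' => ?_)
      have := V.2.1.memMaxIdeal_add h' (h V hV)
      rw [AddSubgroupClass.coe_sub, Subring.coe_one, sub_add_cancel] at this
      exact not_memMaxIdeal_one _ this
    · exact Or.inl (isUnit_sInf_of_forall_not_memMaxIdeal ⟨V₀, hV₀⟩ a.2 h)
  · have hle : D ≤ sInf (Subtype.val '' Z) := fun x hx =>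
      mem_sInf_val_image.2 fun V _ => V.2.2.1 hx
    exact dominates_of_le hle fun x hx =>
      memMaxIdeal_sInf (hle hx.mem) hV₀ ((V₀.2.2.2 x hx.mem).1 hx)
  · intro x hx
    obtain ⟨p, hpm, hp⟩ := exists_monic_forall_memMaxIdeal hcl (mem_sInf_val_image.1 hx)
    have hev : (p.map D.subtype).eval x = aeval x p := eval_map _ _
    refine ⟨p.map D.subtype, hpm.map _, fun i => ?_, ?_⟩
    · rw [coeff_map]
      exact (p.coeff i).2
    · rw [hev]
      exact memMaxIdeal_sInf
        (mem_sInf_val_image.2 fun V hV => (hp V hV).mem) hV₀ (hp V₀ hV₀)
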